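/- arXiv:2008.02945 — 8 statements merged into one kernel-verified Lean document; each statement's English description precedes it below -/
import Mathlib

section
/- For all integers i > 2 and j > 1, the recursively defined integers a_{ij} satisfy the simplified recursion a_{ij} = 2·a_{i-1,j-1} − a_{i-2,j-1}. -/
/-- For positive integers `i, j`, the integers `a i j` are defined recursively by
`a 1 1 = -1`, `a 2 1 = 1`, `a 1 j = 0` for `j > 1`, `a i 1 = 0` for `i > 2`, and
`a i j = (∑_{l=1}^{i-1} a l (j-1)) - (∑_{l=1}^{i-1} a l j) + a (i-1) (j-1)` for `i, j > 1`.
These conditions determine `a` uniquely on positive indices, so we take them as hypotheses.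
For all `i > 2` and `j > 1`, the simplified recursion `a i j = 2 * a (i-1) (j-1) - a (i-2) (j-1)`
holds. -/
theorem simplified_recursion (a : ℕ → ℕ → ℤ)
    (h11 : a 1 1 = -1) (h21 : a 2 1 = 1)
    (h1j : ∀ j : ℕ, 1 < j → a 1 j = 0)
    (hi1 : ∀ i : ℕ, 2 < i → a i 1 = 0)
    (hrec : ∀ i j : ℕ, 1 < i → 1 < j →
      a i j = (∑ l ∈ Finset.Icc 1 (i - 1), a l (j - 1))
            - (∑ l ∈ Finset.Icc 1 (i - 1), a l j) + a (i - 1) (j - 1)) :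
    ∀ i j : ℕ, 2 < i → 1 < j →
      a i j = 2 * a (i - 1) (j - 1) - a (i - 2) (j - 1) := by
  intro i j hi hj
  obtain ⟨k, rfl⟩ : ∃ k, i = k + 3 := ⟨i - 3, by omega⟩
  have h := hrec (k + 3) j (by omega) hj
  have h' := hrec (k + 2) j (by omega) hj
  simp only [show k + 3 - 1 = k + 1 + 1 from rfl, show k + 2 - 1 = k + 1 from rfl,
    show k + 3 - 2 = k + 1 from rfl,
    Finset.sum_Icc_succ_top (show 1 ≤ k + 1 + 1 by omega)] at h h' ⊢
  linarith
end

section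
/- For all integers i > 1 and j > 1, the recursively defined integers a_{ij} satisfy a_{ij} = (−1)^{i−j−1}·2^{2j−i}·C(j−1, i−j−1) − (−1)^{i−j}·2^{2j−i−1}·C(j−1, i−j), where C(l,m) denotes the binomial coefficient for 0 ≤ m ≤ l and is 0 otherwise, and where each of the two terms is interpreted as 0 whenever its binomial coefficient is 0 (in particular this happens whenever the corresponding exponent of 2 is negative). -/
/-- The binomial coefficient `C l m` for integer arguments: it is the usual binomial
coefficient when `0 ≤ m ≤ l` and `0` otherwise. -/
def intChoose (l m : ℤ) : ℤ :=
  if 0 ≤ m ∧ m ≤ l then (l.toNat).choose m.toNat else 0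

theorem intChoose_natCast (n k : ℕ) : intChoose n k = n.choose k := by
  unfold intChoose
  split_ifs with h
  · simp
  · rw [Nat.choose_eq_zero_of_lt (by omega)]
    simp

theorem intChoose_of_neg (n : ℤ) {k : ℤ} (hk : k < 0) : intChoose n k = 0 :=
  if_neg (by omega)

theorem intChoose_succ (n : ℕ) (k : ℤ) :
    intChoose (n + 1) k = intChoose n k + intChoose n (k - 1) := by
  rcases lt_or_ge k 0 with hk | hk
  · simp [intChoose_of_neg _ hk, intChoose_of_neg _ (show k - 1 < 0 by omega)]
  · lift k to ℕ using hk
    cases k with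
    | zero =>
      have h₁ := intChoose_natCast (n + 1) 0
      have h₂ := intChoose_natCast n 0
      have h₃ := intChoose_of_neg n (show (-1 : ℤ) < 0 by omega)
      push_cast at h₁ h₂ ⊢
      simp [h₁, h₂, h₃]
    | succ k =>
      have h₁ := intChoose_natCast (n + 1) (k + 1)
      have h₂ := intChoose_natCast n (k + 1)
      have h₃ := intChoose_natCast n k
      rw [Nat.choose_succ_succ'] at h₁
      push_cast at h₁ h₂ ⊢
      rw [h₁, h₂, add_sub_cancel_right, h₃, add_comm]

/-- The coefficient of `x ^ k` in `(2 - x) ^ n`. -/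
def twoSubCoeff (n k : ℤ) : ℚ :=
  (-1) ^ k * 2 ^ (n - k) * intChoose n k

theorem twoSubCoeff_of_neg (n : ℤ) {k : ℤ} (hk : k < 0) : twoSubCoeff n k = 0 := by
  simp [twoSubCoeff, intChoose_of_neg n hk]

theorem twoSubCoeff_succ (n : ℕ) (k : ℤ) :
    twoSubCoeff (n + 1) k = 2 * twoSubCoeff n k - twoSubCoeff n (k - 1) := by
  have h₁ : (-1 : ℚ) ^ (k - 1) = -(-1) ^ k := by
    rw [zpow_sub_one₀ (by norm_num)]
    norm_num
  have h₂ : (2 : ℚ) ^ ((n : ℤ) + 1 - k) = 2 * 2 ^ ((n : ℤ) - k) := by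
    rw [← zpow_one_add₀ (by norm_num)]
    congr 1
    ring
  have h₃ : (n : ℤ) - (k - 1) = n + 1 - k := by ring
  simp only [twoSubCoeff, intChoose_succ, h₁, h₃, h₂]
  push_cast
  ring

theorem twoSubCoeff_zero_left (k : ℤ) : twoSubCoeff 0 k = if k = 0 then 1 else 0 := by
  split_ifs with hk
  · simp [twoSubCoeff, intChoose, hk]
  · have h : intChoose 0 k = 0 := if_neg (by omega)
    simp [twoSubCoeff, h]

/-- The coefficient of `x ^ i` in `x ^ (n + 1) * (2 - x) ^ n * (x - 1)`. -/
def closedForm (i n : ℕ) : ℚ :=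
  twoSubCoeff n ((i : ℤ) - n - 2) - twoSubCoeff n ((i : ℤ) - n - 1)

theorem closedForm_of_le {i n : ℕ} (h : i ≤ n) : closedForm i n = 0 := by
  simp [closedForm, twoSubCoeff_of_neg _ (show (i : ℤ) - n - 2 < 0 by omega),
    twoSubCoeff_of_neg _ (show (i : ℤ) - n - 1 < 0 by omega)]

theorem closedForm_succ_succ (i n : ℕ) :
    closedForm (i + 2) (n + 1) = 2 * closedForm (i + 1) n - closedForm i n := by
  have e₁ : ((i + 2 : ℕ) : ℤ) - (n + 1 : ℕ) - 2 = i - n - 1 := by push_cast; ring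
  have e₂ : ((i + 2 : ℕ) : ℤ) - (n + 1 : ℕ) - 1 = i - n := by push_cast; ring
  have e₃ : ((i + 1 : ℕ) : ℤ) - n - 2 = i - n - 1 := by push_cast; ring
  have e₄ : ((i + 1 : ℕ) : ℤ) - n - 1 = i - n := by push_cast; ring
  have e₅ : (i : ℤ) - n - 1 - 1 = i - n - 2 := by ring
  simp only [closedForm, e₁, e₂, e₃, e₄]
  push_cast
  rw [twoSubCoeff_succ, twoSubCoeff_succ, e₅]
  ring

/-- For positive integers `i, j`, the integers `a i j` are defined recursively by
`a 1 1 = -1`, `a 2 1 = 1`, `a 1 j = 0` for `j > 1`, `a i 1 = 0` for `i > 2`, and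
`a i j = (∑_{l=1}^{i-1} a l (j-1)) - (∑_{l=1}^{i-1} a l j) + a (i-1) (j-1)` for `i, j > 1`.
For all `i > 1` and `j > 1`,
`a i j = (-1)^(i-j-1) * 2^(2j-i) * C (j-1) (i-j-1) - (-1)^(i-j) * 2^(2j-i-1) * C (j-1) (i-j)`,
where `C l m` is the binomial coefficient for `0 ≤ m ≤ l` and `0` otherwise.  The identity is
stated in `ℚ` (with integer power `zpow`), so that each of the two terms is automatically `0`
whenever its binomial coefficient is `0` (in particular whenever the corresponding exponent of
`2` is negative). -/
theorem closed_formula (a : ℕ → ℕ → ℤ)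
    (h11 : a 1 1 = -1) (h21 : a 2 1 = 1)
    (h1j : ∀ j : ℕ, 1 < j → a 1 j = 0)
    (hi1 : ∀ i : ℕ, 2 < i → a i 1 = 0)
    (hrec : ∀ i j : ℕ, 1 < i → 1 < j →
      a i j = (∑ l ∈ Finset.Icc 1 (i - 1), a l (j - 1))
            - (∑ l ∈ Finset.Icc 1 (i - 1), a l j) + a (i - 1) (j - 1)) :
    ∀ i j : ℕ, 1 < i → 1 < j →
      (a i j : ℚ) =
        (-1 : ℚ) ^ ((i : ℤ) - j - 1) * (2 : ℚ) ^ (2 * (j : ℤ) - i) *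
            (intChoose ((j : ℤ) - 1) ((i : ℤ) - j - 1) : ℚ)
        - (-1 : ℚ) ^ ((i : ℤ) - j) * (2 : ℚ) ^ (2 * (j : ℤ) - i - 1) *
            (intChoose ((j : ℤ) - 1) ((i : ℤ) - j) : ℚ) := by
  have step : ∀ i j : ℕ, 1 ≤ i → 1 < j →
      a (i + 2) j = 2 * a (i + 1) (j - 1) - a i (j - 1) := by
    intro i j hi hj
    have h₁ := hrec (i + 2) j (by omega) hj
    have h₂ := hrec (i + 1) j (by omega) hj
    simp only [Nat.add_sub_cancel, show i + 2 - 1 = i + 1 by omega,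
      Finset.sum_Icc_succ_top (show 1 ≤ i + 1 by omega)] at h₁ h₂
    linarith
  have key : ∀ n i : ℕ, 1 ≤ i → (a i (n + 1) : ℚ) = closedForm i n := by
    intro n
    induction n with
    | zero =>
      intro i hi
      simp only [closedForm, Nat.cast_zero, twoSubCoeff_zero_left]
      obtain rfl | rfl | hi : i = 1 ∨ i = 2 ∨ 2 < i := by omega
      · simp [h11]
      · simp [h21]
      · rw [hi1 i hi, if_neg (by omega), if_neg (by omega)]
        simp
    | succ n ih =>
      intro i hi
      obtain rfl | rfl | ⟨k, hk, rfl⟩ : i = 1 ∨ i = 2 ∨ ∃ k, 1 ≤ k ∧ i = k + 2 := by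
        by_cases h : 2 < i
        · exact Or.inr (Or.inr ⟨i - 2, by omega, by omega⟩)
        · omega
      · rw [h1j _ (by omega), closedForm_of_le (by omega), Int.cast_zero]
      · have h := hrec 2 (n + 1 + 1) (by omega) (by omega)
        have h₁ := closedForm_succ_succ 0 n
        rw [closedForm_of_le (Nat.zero_le n), ← ih 1 le_rfl] at h₁
        simp only [Nat.add_sub_cancel, show 2 - 1 = 1 from rfl, Finset.Icc_self,
          Finset.sum_singleton, h1j (n + 1 + 1) (by omega)] at h
        rw [h₁, h]
        push_cast
        ring
      · rw [step k _ hk (by omega), closedForm_succ_succ, ← ih k hk, ← ih (k + 1) (by omega)]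
        push_cast
        simp
  intro i j hi hj
  obtain ⟨n, rfl⟩ : ∃ n, j = n + 1 := ⟨j - 1, by omega⟩
  rw [key n i hi.le, closedForm, twoSubCoeff, twoSubCoeff]
  push_cast
  have e₁ : (i : ℤ) - n - 2 = i - (n + 1) - 1 := by ring
  have e₂ : (i : ℤ) - n - 1 = i - (n + 1) := by ring
  have e₃ : (n : ℤ) - (i - (n + 1) - 1) = 2 * (n + 1) - i := by ring
  have e₄ : (n : ℤ) - (i - (n + 1)) = 2 * (n + 1) - i - 1 := by ring
  rw [e₁, e₂, e₃, e₄, add_sub_cancel_right]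
end

section
/- For every positive integer n, the n-th row sum of the recursively defined integers a_{ij} equals −1, i.e., ∑_{j=1}^{n} a_{nj} = −1. -/
/-- For positive integers `i, j`, the integers `a i j` are defined recursively by
`a 1 1 = -1`, `a 2 1 = 1`, `a 1 j = 0` for `j > 1`, `a i 1 = 0` for `i > 2`, and
`a i j = (∑_{l=1}^{i-1} a l (j-1)) - (∑_{l=1}^{i-1} a l j) + a (i-1) (j-1)` for `i, j > 1`.
For every positive integer `n`, the `n`-th row sum equals `-1`:
`∑_{j=1}^{n} a n j = -1`. -/
theorem row_sum_eq_neg_one (a : ℕ → ℕ → ℤ)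
    (h11 : a 1 1 = -1) (h21 : a 2 1 = 1)
    (h1j : ∀ j : ℕ, 1 < j → a 1 j = 0)
    (hi1 : ∀ i : ℕ, 2 < i → a i 1 = 0)
    (hrec : ∀ i j : ℕ, 1 < i → 1 < j →
      a i j = (∑ l ∈ Finset.Icc 1 (i - 1), a l (j - 1))
            - (∑ l ∈ Finset.Icc 1 (i - 1), a l j) + a (i - 1) (j - 1)) :
    ∀ n : ℕ, 0 < n → ∑ j ∈ Finset.Icc 1 n, a n j = -1 := by
  have upper_zero : ∀ i : ℕ, 0 < i → ∀ j : ℕ, i < j → a i j = 0 := by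
    intro i
    induction i using Nat.strong_induction_on with
    | _ i ih =>
      intro hi j hij
      obtain rfl | hi' : i = 1 ∨ 1 < i := by omega
      · exact h1j j hij
      · rw [hrec i j hi' (by omega), ih (i - 1) (by omega) (by omega) (j - 1) (by omega),
          Finset.sum_eq_zero, Finset.sum_eq_zero]
        · ring
        · intro l hl
          rw [Finset.mem_Icc] at hl
          exact ih l (by omega) (by omega) j (by omega)
        · intro l hl
          rw [Finset.mem_Icc] at hl
          exact ih l (by omega) (by omega) (j - 1) (by omega)
  have first_column : ∀ m : ℕ, ∑ l ∈ Finset.Icc 1 (m + 2), a l 1 = 0 := by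
    intro m
    induction m with
    | zero => simp [Finset.sum_Icc_succ_top, h11, h21]
    | succ m ih =>
      rw [Finset.sum_Icc_succ_top (by omega), hi1 _ (by omega), add_zero]
      exact ih
  have telescope : ∀ m k : ℕ, 0 < m → ∑ j ∈ Finset.Icc 1 (k + 1), a (m + 1) j =
      a (m + 1) 1 + ∑ l ∈ Finset.Icc 1 m, a l 1 - ∑ l ∈ Finset.Icc 1 m, a l (k + 1)
        + ∑ j ∈ Finset.Icc 1 k, a m j := by
    intro m k hm
    induction k with
    | zero => simp
    | succ k ih =>
      rw [Finset.sum_Icc_succ_top (by omega), ih, hrec (m + 1) (k + 1 + 1) (by omega) (by omega),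
        Finset.sum_Icc_succ_top (by omega) (a m)]
      simp only [Nat.add_sub_cancel]
      ring
  intro n hn
  induction n, hn using Nat.le_induction with
  | base => simp [h11]
  | succ m hm ih =>
    have last_column : ∑ l ∈ Finset.Icc 1 m, a l (m + 1) = 0 := by
      refine Finset.sum_eq_zero fun l hl => ?_
      rw [Finset.mem_Icc] at hl
      exact upper_zero l (by omega) _ (by omega)
    rw [telescope m m hm, ih, last_column]
    obtain rfl | ⟨k, rfl⟩ : m = 1 ∨ ∃ k, m = k + 2 := by
      rcases m with _ | _ | k
      · omega
      · exact Or.inl rfl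
      · exact Or.inr ⟨k, rfl⟩
    · simp [h11, h21]
    · rw [first_column, hi1 _ (by omega)]
      ring
end

section
/- For every positive integer n, the diagonal entry of the recursively defined integers a_{ij} satisfies a_{nn} = −2^{n−1}. -/
/-- For positive integers `i, j`, the integers `a i j` are defined recursively by
`a 1 1 = -1`, `a 2 1 = 1`, `a 1 j = 0` for `j > 1`, `a i 1 = 0` for `i > 2`, and
`a i j = (∑_{l=1}^{i-1} a l (j-1)) - (∑_{l=1}^{i-1} a l j) + a (i-1) (j-1)` for `i, j > 1`.
For every positive integer `n`, the diagonal entry satisfies `a n n = -2^(n-1)`. -/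
theorem diagonal_entry (a : ℕ → ℕ → ℤ)
    (h11 : a 1 1 = -1) (h21 : a 2 1 = 1)
    (h1j : ∀ j : ℕ, 1 < j → a 1 j = 0)
    (hi1 : ∀ i : ℕ, 2 < i → a i 1 = 0)
    (hrec : ∀ i j : ℕ, 1 < i → 1 < j →
      a i j = (∑ l ∈ Finset.Icc 1 (i - 1), a l (j - 1))
            - (∑ l ∈ Finset.Icc 1 (i - 1), a l j) + a (i - 1) (j - 1)) :
    ∀ n : ℕ, 0 < n → a n n = -2 ^ (n - 1) := by
  have upper : ∀ i : ℕ, 0 < i → ∀ j : ℕ, i < j → a i j = 0 := by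
    intro i
    induction i using Nat.strong_induction_on with
    | _ i ih =>
      intro hi j hij
      obtain rfl | hi' : i = 1 ∨ 1 < i := by omega
      · exact h1j j hij
      rw [hrec i j hi' (by omega), ih (i - 1) (by omega) (by omega) (j - 1) (by omega),
        Finset.sum_eq_zero, Finset.sum_eq_zero]
      · simp
      all_goals
        intro l hl
        rw [Finset.mem_Icc] at hl
        exact ih l (by omega) (by omega) _ (by omega)
  intro n hn
  induction n, hn using Nat.le_induction with
  | base => simpa using h11
  | succ n hn ih =>
    have hdiag : ∑ l ∈ Finset.Icc 1 n, a l n = a n n := by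
      refine Finset.sum_eq_single_of_mem n (Finset.mem_Icc.2 ⟨hn, le_rfl⟩) fun l hl hne => ?_
      rw [Finset.mem_Icc] at hl
      exact upper l (by omega) n (by omega)
    have hzero : ∑ l ∈ Finset.Icc 1 n, a l (n + 1) = 0 := by
      refine Finset.sum_eq_zero fun l hl => ?_
      rw [Finset.mem_Icc] at hl
      exact upper l (by omega) (n + 1) (by omega)
    obtain ⟨m, rfl⟩ : ∃ m, n = m + 1 := ⟨n - 1, by omega⟩
    rw [hrec _ _ (by omega) (by omega)]
    simp only [Nat.add_sub_cancel] at ih ⊢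
    rw [hdiag, hzero, ih]
    ring
end

section
/- For all positive integers n and l with l > n, the recursively defined integer a_{nl} equals 0. -/
/-- For positive integers `i, j`, the integers `a i j` are defined recursively by
`a 1 1 = -1`, `a 2 1 = 1`, `a 1 j = 0` for `j > 1`, `a i 1 = 0` for `i > 2`, and
`a i j = (∑_{l=1}^{i-1} a l (j-1)) - (∑_{l=1}^{i-1} a l j) + a (i-1) (j-1)` for `i, j > 1`.
For all positive integers `n` and `l` with `l > n`, one has `a n l = 0`. -/
theorem above_diagonal_zero (a : ℕ → ℕ → ℤ)
    (h11 : a 1 1 = -1) (h21 : a 2 1 = 1)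
    (h1j : ∀ j : ℕ, 1 < j → a 1 j = 0)
    (hi1 : ∀ i : ℕ, 2 < i → a i 1 = 0)
    (hrec : ∀ i j : ℕ, 1 < i → 1 < j →
      a i j = (∑ l ∈ Finset.Icc 1 (i - 1), a l (j - 1))
            - (∑ l ∈ Finset.Icc 1 (i - 1), a l j) + a (i - 1) (j - 1)) :
    ∀ n l : ℕ, 0 < n → n < l → a n l = 0 := by
  intro n
  induction n using Nat.strong_induction_on with
  | _ n ih =>
    intro l hn hl
    obtain rfl | hn1 : n = 1 ∨ 1 < n := by omega
    · exact h1j l hl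
    · have hprev : ∑ k ∈ Finset.Icc 1 (n - 1), a k (l - 1) = 0 :=
        Finset.sum_eq_zero fun k hk => by
          rw [Finset.mem_Icc] at hk
          exact ih k (by omega) _ (by omega) (by omega)
      have hcol : ∑ k ∈ Finset.Icc 1 (n - 1), a k l = 0 :=
        Finset.sum_eq_zero fun k hk => by
          rw [Finset.mem_Icc] at hk
          exact ih k (by omega) _ (by omega) (by omega)
      rw [hrec n l hn1 (by omega), hprev, hcol,
        ih (n - 1) (by omega) (l - 1) (by omega) (by omega)]
      norm_num
end

section
/- For all positive integers m ≤ n, the recursively defined integers a_{ij} satisfy ∑_{j=m}^{n} a_{nj} + ∑_{j=m}^{n} a_{jm} = ∑_{j=m+1}^{n+1} a_{n+1,j}. -/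
/-- For positive integers `i, j`, the integers `a i j` are defined recursively by
`a 1 1 = -1`, `a 2 1 = 1`, `a 1 j = 0` for `j > 1`, `a i 1 = 0` for `i > 2`, and
`a i j = (∑_{l=1}^{i-1} a l (j-1)) - (∑_{l=1}^{i-1} a l j) + a (i-1) (j-1)` for `i, j > 1`.
For all positive integers `m ≤ n`:
`∑_{j=m}^{n} a n j + ∑_{j=m}^{n} a j m = ∑_{j=m+1}^{n+1} a (n+1) j`. -/
theorem sum_identity (a : ℕ → ℕ → ℤ)
    (h11 : a 1 1 = -1) (h21 : a 2 1 = 1)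
    (h1j : ∀ j : ℕ, 1 < j → a 1 j = 0)
    (hi1 : ∀ i : ℕ, 2 < i → a i 1 = 0)
    (hrec : ∀ i j : ℕ, 1 < i → 1 < j →
      a i j = (∑ l ∈ Finset.Icc 1 (i - 1), a l (j - 1))
            - (∑ l ∈ Finset.Icc 1 (i - 1), a l j) + a (i - 1) (j - 1)) :
    ∀ m n : ℕ, 0 < m → m ≤ n →
      (∑ j ∈ Finset.Icc m n, a n j) + (∑ j ∈ Finset.Icc m n, a j m)
        = ∑ j ∈ Finset.Icc (m + 1) (n + 1), a (n + 1) j := by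
  intro m n hm hmn
  have upper : ∀ i j : ℕ, 1 ≤ i → i < j → a i j = 0 := by
    intro i
    induction i using Nat.strong_induction_on with
    | _ i ih =>
      intro j hi hij
      obtain rfl | hi' := Nat.eq_or_lt_of_le hi
      · exact h1j j hij
      · have vanish : ∀ k, i - 1 < k → ∑ l ∈ Finset.Icc 1 (i - 1), a l k = 0 := by
          intro k hk
          refine Finset.sum_eq_zero fun l hl => ?_
          rw [Finset.mem_Icc] at hl
          exact ih l (by omega) k hl.1 (by omega)
        rw [hrec i j hi' (by omega), vanish (j - 1) (by omega), vanish j (by omega),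
          ih (i - 1) (by omega) (j - 1) (by omega) (by omega)]
        simp
  have column : ∑ j ∈ Finset.Icc m n, a j m = ∑ l ∈ Finset.Icc 1 n, a l m := by
    refine Finset.sum_subset (Finset.Icc_subset_Icc_left hm) fun l hl hl' => ?_
    rw [Finset.mem_Icc] at hl hl'
    exact upper l m hl.1 (by omega)
  have last : ∑ l ∈ Finset.Icc 1 n, a l (n + 1) = 0 :=
    Finset.sum_eq_zero fun l hl => by
      rw [Finset.mem_Icc] at hl
      exact upper l (n + 1) hl.1 (by omega)
  have shift : ∑ j ∈ Finset.Icc (m + 1) (n + 1), a (n + 1) j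
      = ∑ j ∈ Finset.Ico m (n + 1), a (n + 1) (j + 1) := by
    rw [Finset.sum_Ico_add' (fun j => a (n + 1) j)]
    rfl
  have step : ∀ j ∈ Finset.Ico m (n + 1), a (n + 1) (j + 1)
      = a n j - (∑ l ∈ Finset.Icc 1 n, a l (j + 1) - ∑ l ∈ Finset.Icc 1 n, a l j) := by
    intro j hj
    rw [Finset.mem_Ico] at hj
    rw [hrec (n + 1) (j + 1) (by omega) (by omega)]
    simp only [Nat.add_sub_cancel]
    ring
  have row : ∑ j ∈ Finset.Icc m n, a n j = ∑ j ∈ Finset.Ico m (n + 1), a n j := rfl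
  rw [shift, Finset.sum_congr rfl step, Finset.sum_sub_distrib,
    Finset.sum_Ico_sub (fun j => ∑ l ∈ Finset.Icc 1 n, a l j) (by omega), last, column, row]
  ring
end

section
/- For each positive integer n there is exactly one index j with a_{nj} odd, namely j = ⌈n/2⌉ (the least integer greater than or equal to n/2): the integer a_{nj} is odd if and only if j = ⌈n/2⌉. -/
/-- For positive integers `i, j`, the integers `a i j` are defined recursively by
`a 1 1 = -1`, `a 2 1 = 1`, `a 1 j = 0` for `j > 1`, `a i 1 = 0` for `i > 2`, and
`a i j = (∑_{l=1}^{i-1} a l (j-1)) - (∑_{l=1}^{i-1} a l j) + a (i-1) (j-1)` for `i, j > 1`.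
For each positive integer `n` there is exactly one index `j` with `a n j` odd, namely
`j = ⌈n/2⌉` (which equals `(n+1)/2` in natural number division): for every positive `j`,
`a n j` is odd if and only if `j = (n+1)/2`. -/
theorem odd_entry_unique (a : ℕ → ℕ → ℤ)
    (h11 : a 1 1 = -1) (h21 : a 2 1 = 1)
    (h1j : ∀ j : ℕ, 1 < j → a 1 j = 0)
    (hi1 : ∀ i : ℕ, 2 < i → a i 1 = 0)
    (hrec : ∀ i j : ℕ, 1 < i → 1 < j →
      a i j = (∑ l ∈ Finset.Icc 1 (i - 1), a l (j - 1))
            - (∑ l ∈ Finset.Icc 1 (i - 1), a l j) + a (i - 1) (j - 1)) :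
    ∀ n : ℕ, 0 < n → ∀ j : ℕ, 0 < j → (Odd (a n j) ↔ j = (n + 1) / 2) := by
  have three_term : ∀ i j : ℕ, a (i + 3) (j + 2) = 2 * a (i + 2) (j + 1) - a (i + 1) (j + 1) := by
    intro i j
    have h := hrec (i + 3) (j + 2) (by omega) (by omega)
    have h' := hrec (i + 2) (j + 2) (by omega) (by omega)
    have hsum (k : ℕ) : ∑ l ∈ Finset.Icc 1 (i + 2), a l k =
        (∑ l ∈ Finset.Icc 1 (i + 1), a l k) + a (i + 2) k :=
      Finset.sum_Icc_succ_top (by omega) _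
    simp only [show i + 3 - 1 = i + 2 by omega, show i + 2 - 1 = i + 1 by omega,
      show j + 2 - 1 = j + 1 by omega, hsum] at h h'
    linarith
  have main : ∀ n j : ℕ, Odd (a (n + 1) (j + 1)) ↔ j = n / 2 := by
    intro n
    induction n using Nat.twoStepInduction with
    | zero =>
      rintro (_ | j)
      · simp [h11]
      · simp [h1j (j + 1 + 1) (by omega)]
    | one =>
      rintro (_ | j)
      · simp [h21]
      · have h := hrec 2 (j + 2) (by omega) (by omega)
        have h0 := h1j (j + 2) (by omega)
        simp only [show j + 2 - 1 = j + 1 by omega, Nat.reduceSub,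
          Finset.Icc_self, Finset.sum_singleton, h0] at h
        refine iff_of_false ?_ (by omega)
        rw [Int.not_odd_iff_even]
        exact ⟨a 1 (j + 1), by linarith⟩
    | more n ih _ =>
      rintro (_ | j)
      · refine iff_of_false ?_ (by omega)
        simp [hi1 (n + 2 + 1) (by omega)]
      · have h := three_term n j
        have parity : Odd (a (n + 3) (j + 2)) ↔ Odd (a (n + 1) (j + 1)) := by
          simp only [Int.odd_iff]
          omega
        rw [parity, ih]
        omega
  intro n hn j hj
  obtain ⟨n, rfl⟩ := Nat.exists_eq_add_of_lt hn
  obtain ⟨j, rfl⟩ := Nat.exists_eq_add_of_lt hj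
  simp only [zero_add]
  rw [main]
  omega
end

section
/- Let G be a finite group of nilpotency class at most two. In the group of permutations of G^ω, for every positive integer n and all g, h ∈ G one has [x^n·σ_g·x^{−n}, σ_h] = ∏_{j=1}^{n} x^j·σ_{[g⁻¹, h^{a_{nj}}]}·x^{−j}, where the product is taken in increasing order of j, [a,b] = a⁻¹b⁻¹ab, and a_{nj} are the recursively defined integers. -/
/-- The Cayley machine transformation of a group `G` at state `g`, acting on right-infinite
words `w : ℕ → G`: `(cayley g w) n = g * w 0 * w 1 * ⋯ * w n`. -/
def cayley {G : Type*} [Group G] (g : G) : Equiv.Perm (ℕ → G) where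
  toFun w n := g * ((List.range (n + 1)).map w).prod
  invFun v n :=
    match n with
    | 0 => g⁻¹ * v 0
    | m + 1 => (v m)⁻¹ * v (m + 1)
  left_inv w := by
    funext n
    match n with
    | 0 => simp [List.range_succ]
    | m + 1 => simp [List.range_succ, mul_assoc]
  right_inv v := by
    funext n
    induction n with
    | zero => simp [List.range_succ]
    | succ m ih =>
      beta_reduce at ih ⊢
      rw [List.range_succ, List.map_append, List.prod_append, ← mul_assoc, ih]
      simp [mul_assoc]

/-- The permutation `x = C₁⁻¹`, the inverse of the Cayley machine transformation at the
identity state.  It satisfies `(x w) 0 = w 0` and `(x w) n = (w (n-1))⁻¹ * w n` for `n ≥ 1`. -/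
def xPerm (G : Type*) [Group G] : Equiv.Perm (ℕ → G) := (cayley (1 : G))⁻¹

/-- The permutation `σ_g = x * C_g`, given by `(σ_g w) 0 = g * w 0` and `(σ_g w) n = w n`
for `n ≥ 1`.  The map `g ↦ σ_g` identifies `G` with a subgroup of the automata group. -/
def sigma' {G : Type*} [Group G] (g : G) : Equiv.Perm (ℕ → G) := xPerm G * cayley g

open PowerSeries in
/-- The coefficientwise (Hadamard) product of two power series. -/
noncomputable def hadamard (p q : PowerSeries ℤ) : PowerSeries ℤ :=
  PowerSeries.mk fun m => coeff m p * coeff m q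

/-- The geometric series `1 + X + X² + ⋯`, the inverse of `1 - X`. -/
noncomputable def geom : PowerSeries ℤ := PowerSeries.mk fun _ => 1

/-- The exponent series produced by applying `x` `k` times to a pair of shifts of a word, the
second shift being `geom ^ (k + r)` at the start; see `defect_xPerm_pow`. -/
noncomputable def defectSeries : ℕ → ℕ → PowerSeries ℤ
  | 0, _ => 0
  | k + 1, r => (1 - PowerSeries.X) * defectSeries k (r + 1) +
      hadamard ((1 - PowerSeries.X) ^ (k + 1)) (PowerSeries.X * geom ^ (r + 1))

/-- Right multiplication of words by the sequence of powers of `c` with exponents the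
coefficients of `e`. -/
noncomputable def shiftBy {G : Type*} [Group G] (c : G) (e : PowerSeries ℤ) :
    Equiv.Perm (ℕ → G) where
  toFun w m := w m * c ^ PowerSeries.coeff m e
  invFun w m := w m * (c ^ PowerSeries.coeff m e)⁻¹
  left_inv w := by funext m; simp
  right_inv w := by funext m; simp

section Series

open PowerSeries

theorem one_sub_X_mul_geom : (1 - X : PowerSeries ℤ) * geom = 1 := by
  rw [mul_comm]
  exact PowerSeries.mk_one_mul_one_sub_eq_one ℤ

theorem coeff_zero_one_sub_X_mul (p : PowerSeries ℤ) :
    coeff 0 ((1 - X) * p) = coeff 0 p := by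
  simp [sub_mul]

theorem coeff_succ_one_sub_X_mul (p : PowerSeries ℤ) (m : ℕ) :
    coeff (m + 1) ((1 - X) * p) = coeff (m + 1) p - coeff m p := by
  simp [sub_mul, coeff_succ_X_mul]

theorem coeff_zero_one_sub_X_pow (k : ℕ) :
    coeff 0 ((1 - X : PowerSeries ℤ) ^ k) = 1 := by
  simp

theorem hadamard_one_X_mul (q : PowerSeries ℤ) : hadamard 1 (X * q) = 0 := by
  ext m
  cases m <;> simp [hadamard, coeff_one]

theorem hadamard_X_mul_geom (p : PowerSeries ℤ) :
    hadamard p (X * geom) = p - C (coeff 0 p) := by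
  ext m
  rw [map_sub, coeff_C]
  cases m <;> simp [hadamard, geom, coeff_succ_X_mul]

theorem hadamard_recurrence (p q : PowerSeries ℤ) :
    hadamard ((1 - X) * p) (X * q) =
      (1 - X) * hadamard p (X * q) + hadamard ((1 - X) * p) (X * ((1 - X) * q))
        - hadamard p (X * ((1 - X) * q)) := by
  ext m
  rcases m with _ | _ | m
  · simp [hadamard, sub_mul]
  · simp [hadamard, coeff_succ_X_mul, sub_mul]
  · simp only [hadamard, coeff_mk, coeff_succ_X_mul, coeff_succ_one_sub_X_mul, map_add, map_sub]
    ring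

theorem one_sub_X_mul_geom_pow (r : ℕ) :
    (1 - X : PowerSeries ℤ) * geom ^ (r + 1) = geom ^ r := by
  rw [pow_succ', ← mul_assoc, one_sub_X_mul_geom, one_mul]

theorem defectSeries_succ (k r : ℕ) :
    defectSeries (k + 1) r = (1 - X) * defectSeries k (r + 1) +
      hadamard ((1 - X) ^ (k + 1)) (X * geom ^ (r + 1)) := rfl

theorem defectSeries_succ_succ (k r : ℕ) :
    defectSeries (k + 1) (r + 1) =
      (1 - X) * defectSeries k (r + 1) + defectSeries (k + 1) r - defectSeries k r := by
  have key (k r : ℕ) := hadamard_recurrence ((1 - X) ^ k) (geom ^ (r + 2))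
  simp only [one_sub_X_mul_geom_pow, ← pow_succ'] at key
  induction k generalizing r with
  | zero =>
    have h := key 0 r
    simp only [pow_zero, hadamard_one_X_mul] at h
    simp only [defectSeries]
    rw [h]
    ring
  | succ k ih =>
    have h1 := defectSeries_succ (k + 1) (r + 1)
    have h2 := defectSeries_succ (k + 1) r
    have h3 := defectSeries_succ k r
    have h4 := defectSeries_succ k (r + 1)
    linear_combination h1 - h2 + h3 - (1 - X) * h4 + (1 - X) * ih (r + 1) + key (k + 1) r

theorem defectSeries_add_two_zero (n : ℕ) :
    1 + defectSeries (n + 2) 0 =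
      2 * (1 - X) * (1 + defectSeries (n + 1) 0) - (1 - X) * (1 + defectSeries n 0) := by
  have h1 := defectSeries_succ_succ n 0
  have h2 := defectSeries_succ n 0
  rw [defectSeries_succ (n + 1) 0]
  simp only [zero_add, pow_one, hadamard_X_mul_geom, coeff_zero_one_sub_X_pow, map_one] at h1 h2 ⊢
  linear_combination (1 - X) * h1 - (1 - X) * h2

theorem defectSeries_one_zero : 1 + defectSeries 1 0 = 1 - X := by
  rw [defectSeries_succ 0 0]
  simp only [zero_add, pow_one, hadamard_X_mul_geom, defectSeries]
  simp [sub_eq_add_neg]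

theorem relation_coeff_eq_zero (a : ℕ → ℕ → ℤ)
    (h1j : ∀ j : ℕ, 1 < j → a 1 j = 0)
    (hrec : ∀ i j : ℕ, 1 < i → 1 < j →
      a i j = (∑ l ∈ Finset.Icc 1 (i - 1), a l (j - 1))
            - (∑ l ∈ Finset.Icc 1 (i - 1), a l j) + a (i - 1) (j - 1))
    (i j : ℕ) (hi : 0 < i) (hij : i < j) : a i j = 0 := by
  induction i using Nat.strong_induction_on generalizing j with
  | _ i ih =>
    rcases Nat.lt_or_ge 1 i with h | h
    · rw [hrec i j h (by omega), Finset.sum_eq_zero, Finset.sum_eq_zero,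
        ih (i - 1) (by omega) (j - 1) (by omega) (by omega)]
      · simp
      · intro l hl
        rw [Finset.mem_Icc] at hl
        exact ih l (by omega) j (by omega) (by omega)
      · intro l hl
        rw [Finset.mem_Icc] at hl
        exact ih l (by omega) (j - 1) (by omega) (by omega)
    · obtain rfl : i = 1 := by omega
      exact h1j j hij

theorem sum_relation_coeff (a : ℕ → ℕ → ℤ)
    (h11 : a 1 1 = -1) (h21 : a 2 1 = 1)
    (h1j : ∀ j : ℕ, 1 < j → a 1 j = 0)
    (hi1 : ∀ i : ℕ, 2 < i → a i 1 = 0)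
    (hrec : ∀ i j : ℕ, 1 < i → 1 < j →
      a i j = (∑ l ∈ Finset.Icc 1 (i - 1), a l (j - 1))
            - (∑ l ∈ Finset.Icc 1 (i - 1), a l j) + a (i - 1) (j - 1)) (n : ℕ) :
    ∑ k ∈ Finset.range (n + 1), (a (n + 1) (k + 1) : PowerSeries ℤ) * (1 - X) ^ (k + 1) =
      -(1 + defectSeries (n + 1) 0) := by
  have hz := relation_coeff_eq_zero a h1j hrec
  have hrec' (i j : ℕ) : a (i + 3) (j + 2) = 2 * a (i + 2) (j + 1) - a (i + 1) (j + 1) := by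
    have h1 := hrec (i + 3) (j + 2) (by omega) (by omega)
    have h2 := hrec (i + 2) (j + 2) (by omega) (by omega)
    have e (j : ℕ) : ∑ l ∈ Finset.Icc 1 (i + 2), a l j =
        ∑ l ∈ Finset.Icc 1 (i + 1), a l j + a (i + 2) j :=
      Finset.sum_Icc_succ_top (by omega) _
    simp only [show i + 3 - 1 = i + 2 by omega, show i + 2 - 1 = i + 1 by omega,
      show j + 2 - 1 = j + 1 by omega, e] at h1 h2
    linarith
  induction n using Nat.twoStepInduction with
  | zero => simp [defectSeries_one_zero, h11]
  | one =>
    have h22 : a 2 2 = -2 := by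
      rw [hrec 2 2 (by omega) (by omega)]
      simp [h11, h1j 2]
    rw [defectSeries_add_two_zero, defectSeries_one_zero]
    simp [Finset.sum_range_succ, h21, h22, defectSeries]
    ring
  | more n ih1 ih2 =>
    rw [defectSeries_add_two_zero, Finset.sum_range_succ', hi1 (n + 3) (by omega)]
    have e : ∑ k ∈ Finset.range (n + 2), (a (n + 1) (k + 1) : PowerSeries ℤ) *
        (1 - X) ^ (k + 1) = -(1 + defectSeries (n + 1) 0) := by
      rw [Finset.sum_range_succ, ih1, hz (n + 1) (n + 1 + 1) (by omega) (by omega)]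
      simp
    have e' : ∑ k ∈ Finset.range (n + 2), (a (n + 3) (k + 1 + 1) : PowerSeries ℤ) *
        (1 - X) ^ (k + 1 + 1) =
        2 * (1 - X) * (∑ k ∈ Finset.range (n + 2), (a (n + 2) (k + 1) : PowerSeries ℤ) *
          (1 - X) ^ (k + 1)) - (1 - X) * ∑ k ∈ Finset.range (n + 2),
          (a (n + 1) (k + 1) : PowerSeries ℤ) * (1 - X) ^ (k + 1) := by
      rw [Finset.mul_sum, Finset.mul_sum, ← Finset.sum_sub_distrib]
      refine Finset.sum_congr rfl fun k _ => ?_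
      rw [hrec']
      push_cast
      ring
    rw [e', e, ih2]
    simp
    ring

end Series

section Words

open PowerSeries

theorem apply_inv_apply {α : Type*} (f : Equiv.Perm α) (w : α) : f (f⁻¹ w) = w :=
  f.apply_symm_apply w

variable {G : Type*} [Group G]

theorem xPerm_apply_zero (w : ℕ → G) : xPerm G w 0 = w 0 := by
  change (1 : G)⁻¹ * w 0 = w 0
  simp

theorem xPerm_apply_succ (w : ℕ → G) (m : ℕ) :
    xPerm G w (m + 1) = (w m)⁻¹ * w (m + 1) := rfl

theorem cayley_eq (g : G) (w : ℕ → G) (m : ℕ) : cayley g w m = g * cayley 1 w m := by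
  simp [cayley]

theorem sigma'_apply_zero (g : G) (w : ℕ → G) : sigma' g w 0 = g * w 0 := by
  change xPerm G (cayley g w) 0 = _
  rw [xPerm_apply_zero]
  simp [cayley]

theorem sigma'_apply_succ (g : G) (w : ℕ → G) (m : ℕ) : sigma' g w (m + 1) = w (m + 1) := by
  have h : xPerm G (cayley 1 w) = w := (cayley (1 : G)).symm_apply_apply w
  change xPerm G (cayley g w) (m + 1) = _
  rw [xPerm_apply_succ, cayley_eq g w m, cayley_eq g w (m + 1)]
  conv_rhs => rw [← h, xPerm_apply_succ]
  group

theorem shiftBy_apply (c : G) (e : PowerSeries ℤ) (w : ℕ → G) (m : ℕ) :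
    shiftBy c e w m = w m * c ^ coeff m e := rfl

theorem shiftBy_zero (c : G) : shiftBy c 0 = 1 := by
  ext w m
  simp [shiftBy_apply]

theorem shiftBy_add (c : G) (e f : PowerSeries ℤ) :
    shiftBy c (e + f) = shiftBy c e * shiftBy c f := by
  ext w m
  rw [Equiv.Perm.mul_apply, shiftBy_apply, shiftBy_apply, shiftBy_apply, add_comm, map_add,
    zpow_add, mul_assoc]

theorem prod_shiftBy (c : G) (f : ℕ → PowerSeries ℤ) (n : ℕ) :
    ((List.range n).map fun k => shiftBy c (f k)).prod =
      shiftBy c (∑ k ∈ Finset.range n, f k) := by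
  induction n with
  | zero => simp [shiftBy_zero]
  | succ n ih => simp [List.range_succ, Finset.sum_range_succ, shiftBy_add, ih]

theorem sigma'_mul_shiftBy (c g : G) (e : PowerSeries ℤ) :
    sigma' g * shiftBy c e = shiftBy c e * sigma' g := by
  ext w m
  cases m <;>
    simp [shiftBy_apply, sigma'_apply_zero, sigma'_apply_succ, mul_assoc]

theorem sigma'_zpow_eq_shiftBy {c : G} (hc : c ∈ Subgroup.center G) (k : ℤ) :
    sigma' (c ^ k) = shiftBy c (k : PowerSeries ℤ) := by
  have hk := Subgroup.mem_center_iff.1 (zpow_mem hc k)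
  ext w m
  rw [shiftBy_apply, show (k : PowerSeries ℤ) = C k by simp, coeff_C]
  cases m <;> simp [sigma'_apply_zero, sigma'_apply_succ, hk]

theorem xPerm_mul_shiftBy {c : G} (hc : c ∈ Subgroup.center G) (e : PowerSeries ℤ) :
    xPerm G * shiftBy c e = shiftBy c ((1 - X) * e) * xPerm G := by
  ext w m
  cases m with
  | zero =>
    rw [Equiv.Perm.mul_apply, Equiv.Perm.mul_apply, shiftBy_apply, xPerm_apply_zero,
      xPerm_apply_zero, shiftBy_apply, coeff_zero_one_sub_X_mul]
  | succ m =>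
    rw [Equiv.Perm.mul_apply, Equiv.Perm.mul_apply, shiftBy_apply, xPerm_apply_succ,
      xPerm_apply_succ, shiftBy_apply, shiftBy_apply, coeff_succ_one_sub_X_mul, sub_eq_add_neg,
      zpow_add, zpow_neg, ← mul_assoc, mul_inv_rev]
    have h := Subgroup.mem_center_iff.1 (inv_mem (zpow_mem hc (coeff m e)))
    simp only [mul_assoc]
    rw [← h]
    simp only [mul_assoc]

theorem xPerm_pow_mul_shiftBy {c : G} (hc : c ∈ Subgroup.center G) (e : PowerSeries ℤ) (n : ℕ) :
    xPerm G ^ n * shiftBy c e = shiftBy c ((1 - X) ^ n * e) * xPerm G ^ n := by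
  induction n with
  | zero => simp
  | succ n ih =>
    rw [pow_succ', mul_assoc, ih, ← mul_assoc, xPerm_mul_shiftBy hc, mul_assoc, ← mul_assoc (1 - X),
      ← pow_succ']

theorem conj_sigma'_mul_shiftBy {c : G} (hc : c ∈ Subgroup.center G) (g : G)
    (e : PowerSeries ℤ) (n : ℕ) :
    xPerm G ^ n * sigma' g * (xPerm G ^ n)⁻¹ * shiftBy c e =
      shiftBy c e * (xPerm G ^ n * sigma' g * (xPerm G ^ n)⁻¹) := by
  have h := xPerm_pow_mul_shiftBy hc (geom ^ n * e) n
  rw [← mul_assoc, ← mul_pow, one_sub_X_mul_geom, one_pow, one_mul] at h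
  have h' : (xPerm G ^ n)⁻¹ * shiftBy c e = shiftBy c (geom ^ n * e) * (xPerm G ^ n)⁻¹ := by
    rw [inv_mul_eq_iff_eq_mul, ← mul_assoc, h, mul_inv_cancel_right]
  rw [mul_assoc, h', ← mul_assoc, mul_assoc _ (sigma' g), sigma'_mul_shiftBy, ← mul_assoc, h]
  simp only [mul_assoc]

theorem zpow_mul_zpow_of_center {g h c : G} (hc : c ∈ Subgroup.center G)
    (hgh : g * h = h * g * c) (i j : ℤ) :
    g ^ i * h ^ j = h ^ j * g ^ i * c ^ (i * j) := by
  have hcomm (k : ℤ) (y : G) : Commute y (c ^ k) := Subgroup.mem_center_iff.1 (zpow_mem hc k) y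
  have h1 : SemiconjBy h (g * c) g := by
    rw [SemiconjBy, hgh, mul_assoc]
  have h2 := h1.zpow_right i
  rw [(show Commute g c by simpa using hcomm 1 g).mul_zpow] at h2
  have h3 : SemiconjBy (g ^ i) h (h * c ^ i) := by
    rw [SemiconjBy, ← h2.eq, mul_assoc, (hcomm i _).eq]
  have h4 := (h3.zpow_right j).eq
  rw [(hcomm i h).mul_zpow, ← zpow_mul] at h4
  rw [h4, mul_assoc, mul_assoc, (hcomm (i * j) _).eq]

theorem mem_center_of_abelianization_eq_one
    (hG : ∀ g h : G, g⁻¹ * h⁻¹ * g * h ∈ Subgroup.center G) {z : G}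
    (hz : Abelianization.of z = 1) : z ∈ Subgroup.center G := by
  have h : commutator G ≤ Subgroup.center G := by
    rw [commutator_def, Subgroup.commutator_le]
    intro a _ b _
    simpa [commutatorElement_def] using hG a⁻¹ b⁻¹
  apply h
  rw [← Abelianization.ker_of]
  exact hz

theorem mul_comm_of_abelianization_eq
    (hG : ∀ g h : G, g⁻¹ * h⁻¹ * g * h ∈ Subgroup.center G) {g h u v : G} {i j : ℤ}
    (hu : Abelianization.of u = Abelianization.of g ^ i)
    (hv : Abelianization.of v = Abelianization.of h ^ j) :
    u * v = v * u * (g⁻¹ * h⁻¹ * g * h) ^ (i * j) := by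
  have hgh := zpow_mul_zpow_of_center (hG g h) (show g * h = h * g * _ by group) i j
  have hzu : (g ^ i)⁻¹ * u ∈ Subgroup.center G :=
    mem_center_of_abelianization_eq_one hG (by simp [hu])
  have hzv : (h ^ j)⁻¹ * v ∈ Subgroup.center G :=
    mem_center_of_abelianization_eq_one hG (by simp [hv])
  obtain ⟨y, rfl⟩ : ∃ y, u = g ^ i * y := ⟨_, (mul_inv_cancel_left _ _).symm⟩
  obtain ⟨z, rfl⟩ : ∃ z, v = h ^ j * z := ⟨_, (mul_inv_cancel_left _ _).symm⟩
  rw [inv_mul_cancel_left] at hzu hzv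
  have hy := Subgroup.mem_center_iff.1 hzu
  have hz := Subgroup.mem_center_iff.1 hzv
  calc g ^ i * y * (h ^ j * z) = g ^ i * (y * h ^ j) * z := by simp only [mul_assoc]
    _ = g ^ i * h ^ j * (y * z) := by rw [← hy]; simp only [mul_assoc]
    _ = h ^ j * g ^ i * ((g⁻¹ * h⁻¹ * g * h) ^ (i * j) * (y * z)) := by
      rw [hgh, mul_assoc]
    _ = h ^ j * g ^ i * (y * z * (g⁻¹ * h⁻¹ * g * h) ^ (i * j)) := by
      rw [Subgroup.mem_center_iff.1 (mul_mem hzu hzv)]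
    _ = h ^ j * (g ^ i * (z * y)) * (g⁻¹ * h⁻¹ * g * h) ^ (i * j) := by
      rw [hy z]; simp only [mul_assoc]
    _ = h ^ j * z * (g ^ i * y) * (g⁻¹ * h⁻¹ * g * h) ^ (i * j) := by
      rw [← mul_assoc (g ^ i), hz (g ^ i)]; simp only [mul_assoc]

/-- The words `v` and `w` differ, modulo commutators, by powers of `g` with exponents the
coefficients of `p`. -/
def DiffersBy (g : G) (p : PowerSeries ℤ) (v w : ℕ → G) : Prop :=
  ∀ m, Abelianization.of (w m) = Abelianization.of g ^ coeff m p * Abelianization.of (v m)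

theorem DiffersBy.xPerm {g : G} {p : PowerSeries ℤ} {v w : ℕ → G} (h : DiffersBy g p v w) :
    DiffersBy g ((1 - X) * p) (xPerm G v) (xPerm G w) := by
  intro m
  cases m with
  | zero =>
    rw [xPerm_apply_zero, xPerm_apply_zero, coeff_zero_one_sub_X_mul, h 0]
  | succ m =>
    rw [xPerm_apply_succ, xPerm_apply_succ, coeff_succ_one_sub_X_mul, map_mul, map_mul, map_inv,
      map_inv, h m, h (m + 1), zpow_sub, mul_inv]
    ac_rfl

theorem DiffersBy.of_xPerm {g : G} {p : PowerSeries ℤ} {v w : ℕ → G}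
    (h : DiffersBy g ((1 - X) * p) (_root_.xPerm G v) (_root_.xPerm G w)) :
    DiffersBy g p v w := by
  intro m
  induction m with
  | zero => simpa only [xPerm_apply_zero, coeff_zero_one_sub_X_mul] using h 0
  | succ m ih =>
    have h' := h (m + 1)
    rw [xPerm_apply_succ, xPerm_apply_succ, coeff_succ_one_sub_X_mul, map_mul, map_mul, map_inv,
      map_inv, ih, inv_mul_eq_iff_eq_mul, zpow_sub] at h'
    rw [h']
    generalize Abelianization.of g ^ coeff m p = y
    generalize Abelianization.of g ^ coeff (m + 1) p = z
    rw [mul_mul_mul_comm, mul_inv_cancel_left, mul_left_comm, mul_inv_cancel, mul_one]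

theorem DiffersBy.inv_xPerm_pow {g : G} {v w : ℕ → G} (h : DiffersBy g 1 v w) (n : ℕ) :
    DiffersBy g (geom ^ n) ((_root_.xPerm G ^ n)⁻¹ v) ((_root_.xPerm G ^ n)⁻¹ w) := by
  induction n with
  | zero => simpa using h
  | succ n ih =>
    apply DiffersBy.of_xPerm
    rw [one_sub_X_mul_geom_pow, pow_succ, mul_inv_rev, Equiv.Perm.mul_apply, Equiv.Perm.mul_apply,
      apply_inv_apply, apply_inv_apply]
    exact ih

theorem differsBy_sigma' (g : G) (w : ℕ → G) : DiffersBy g 1 w (sigma' g w) := by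
  intro m
  cases m <;> simp [sigma'_apply_zero, sigma'_apply_succ, coeff_one]

theorem defect_xPerm (hG : ∀ g h : G, g⁻¹ * h⁻¹ * g * h ∈ Subgroup.center G) {g h : G}
    {p q e : PowerSeries ℤ} {u v w y : ℕ → G} (hv : DiffersBy g p u v) (hw : DiffersBy h q u w)
    (hy : ∀ m, y m = v m * (u m)⁻¹ * w m * (g⁻¹ * h⁻¹ * g * h) ^ coeff m e) (m : ℕ) :
    xPerm G y m = xPerm G v m * (xPerm G u m)⁻¹ * xPerm G w m *
      (g⁻¹ * h⁻¹ * g * h) ^ coeff m ((1 - X) * e + hadamard ((1 - X) * p) (X * q)) := by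
  have hc := hG g h
  cases m with
  | zero =>
    simp only [xPerm_apply_zero, hy 0, map_add, coeff_zero_one_sub_X_mul]
    simp [hadamard]
  | succ m =>
    have h1 : Abelianization.of (xPerm G v (m + 1) * (xPerm G u (m + 1))⁻¹) =
        Abelianization.of g ^ coeff (m + 1) ((1 - X) * p) := by
      rw [map_mul, hv.xPerm, map_inv, mul_inv_cancel_right]
    have h2 : Abelianization.of ((u m)⁻¹ * w m) = Abelianization.of h ^ coeff m q := by
      rw [map_mul, hw, map_inv, mul_left_comm, inv_mul_cancel, mul_one]
    have h3 := mul_comm_of_abelianization_eq hG h1 h2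
    simp only [xPerm_apply_succ, hy, map_add, coeff_succ_one_sub_X_mul] at h3 ⊢
    simp only [hadamard, coeff_mk, coeff_succ_X_mul, coeff_succ_one_sub_X_mul]
    generalize g⁻¹ * h⁻¹ * g * h = c at *
    generalize (coeff (m + 1) p - coeff m p) * coeff m q = k at *
    rw [zpow_add, sub_eq_add_neg, zpow_add, zpow_neg]
    have hcomm (k : ℤ) := Subgroup.mem_center_iff.1 (zpow_mem hc k)
    have hcomm' := Subgroup.mem_center_iff.1 (inv_mem (zpow_mem hc (coeff m e)))
    generalize c ^ coeff (m + 1) e = c1 at *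
    generalize c ^ coeff m e = c2 at *
    have h4 : ((u m)⁻¹ * w m)⁻¹ * ((v m)⁻¹ * v (m + 1) * ((u m)⁻¹ * u (m + 1))⁻¹) *
        ((u m)⁻¹ * w m) = (v m)⁻¹ * v (m + 1) * ((u m)⁻¹ * u (m + 1))⁻¹ * c ^ k := by
      rw [mul_assoc, inv_mul_eq_iff_eq_mul, h3, mul_assoc]
    calc _ = c2⁻¹ * (((u m)⁻¹ * w m)⁻¹ * ((v m)⁻¹ * v (m + 1) * ((u m)⁻¹ * u (m + 1))⁻¹) *
          ((u m)⁻¹ * w m) * ((w m)⁻¹ * w (m + 1))) * c1 := by group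
      _ = (v m)⁻¹ * v (m + 1) * ((u m)⁻¹ * u (m + 1))⁻¹ * (c ^ k * ((w m)⁻¹ * w (m + 1)))
          * (c2⁻¹ * c1) := by
        rw [h4, ← hcomm']; simp only [mul_assoc]
      _ = (v m)⁻¹ * v (m + 1) * ((u m)⁻¹ * u (m + 1))⁻¹ * ((w m)⁻¹ * w (m + 1)) *
          (c ^ k * (c2⁻¹ * c1)) := by
        rw [← hcomm]; simp only [mul_assoc]
      _ = _ := by rw [← hcomm k, ← hcomm' c1]

theorem defect_xPerm_pow (hG : ∀ g h : G, g⁻¹ * h⁻¹ * g * h ∈ Subgroup.center G) {g h : G}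
    {u v w y : ℕ → G} (k r : ℕ) (hv : DiffersBy g 1 u v) (hw : DiffersBy h (geom ^ (k + r)) u w)
    (hy : ∀ m, y m = v m * (u m)⁻¹ * w m) :
    DiffersBy g ((1 - X) ^ k) ((xPerm G ^ k) u) ((xPerm G ^ k) v) ∧
    DiffersBy h (geom ^ r) ((xPerm G ^ k) u) ((xPerm G ^ k) w) ∧
    ∀ m, (xPerm G ^ k) y m =
      (xPerm G ^ k) v m * ((xPerm G ^ k) u m)⁻¹ * (xPerm G ^ k) w m *
        (g⁻¹ * h⁻¹ * g * h) ^ coeff m (defectSeries k r) := by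
  induction k generalizing r with
  | zero => exact ⟨by simpa using hv, by simpa using hw, by simpa [defectSeries] using hy⟩
  | succ k ih =>
    obtain ⟨h1, h2, h3⟩ := ih (r + 1) (by rwa [show k + (r + 1) = k + 1 + r by omega])
    have h4 := h2.xPerm
    rw [one_sub_X_mul_geom_pow] at h4
    have h5 := defect_xPerm hG h1 h2 h3
    rw [← pow_succ'] at h5
    rw [pow_succ' (xPerm G)]
    exact ⟨by rw [pow_succ']; exact h1.xPerm, h4, h5⟩

theorem conj_sigma'_mul_sigma' (hG : ∀ g h : G, g⁻¹ * h⁻¹ * g * h ∈ Subgroup.center G)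
    (g h : G) (n : ℕ) :
    xPerm G ^ n * sigma' g * (xPerm G ^ n)⁻¹ * sigma' h =
      shiftBy (g⁻¹ * h⁻¹ * g * h) (1 + defectSeries n 0) *
        (sigma' h * (xPerm G ^ n * sigma' g * (xPerm G ^ n)⁻¹)) := by
  ext w m
  obtain ⟨h1, -, h3⟩ := defect_xPerm_pow hG n 0 (differsBy_sigma' g ((xPerm G ^ n)⁻¹ w))
    ((differsBy_sigma' h w).inv_xPerm_pow n)
    (y := sigma' g ((xPerm G ^ n)⁻¹ (sigma' h w)))
    (by
      intro m
      cases m <;> simp [sigma'_apply_zero, sigma'_apply_succ])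
  have h3 := h3 m
  simp only [apply_inv_apply] at h1 h3
  simp only [Equiv.Perm.mul_apply, shiftBy_apply]
  rw [h3, map_add, zpow_add, ← mul_assoc]
  congr 1
  cases m with
  | zero =>
    have h4 := h1 0
    have h5 := mul_comm_of_abelianization_eq hG (g := g) (h := h) (i := 1) (j := 1)
      (u := (xPerm G ^ n) (sigma' g ((xPerm G ^ n)⁻¹ w)) 0 * (w 0)⁻¹) (v := h)
      (by rw [map_mul, h4, coeff_zero_one_sub_X_pow, map_inv, mul_inv_cancel_right])
      (by simp)
    have hc := Subgroup.mem_center_iff.1 (hG g h) (w 0)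
    rw [sigma'_apply_zero, sigma'_apply_zero, ← mul_assoc, h5]
    simp only [mul_one, zpow_one, coeff_zero_one]
    rw [mul_assoc _ _ (w 0), ← hc]
    simp only [mul_assoc, inv_mul_cancel_left]
  | succ m => simp [sigma'_apply_succ, coeff_one]

end Words

/-- Let `G` be a finite group of nilpotency class at most two (every commutator
`g⁻¹h⁻¹gh` is central).  For every positive integer `n` and all `g, h ∈ G`, in the
permutation group of `G^ω`:
`[xⁿ σ_g x⁻ⁿ, σ_h] = ∏_{j=1}^{n} x^j σ_{[g⁻¹, h^{a n j}]} x⁻ʲ`,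
the product taken in increasing order of `j`, where `[a,b] = a⁻¹b⁻¹ab` and `a` is the
recursively defined integer array. -/
theorem main_relations {G : Type*} [Group G] [Finite G]
    (hG : ∀ g h : G, g⁻¹ * h⁻¹ * g * h ∈ Subgroup.center G)
    (a : ℕ → ℕ → ℤ)
    (h11 : a 1 1 = -1) (h21 : a 2 1 = 1)
    (h1j : ∀ j : ℕ, 1 < j → a 1 j = 0)
    (hi1 : ∀ i : ℕ, 2 < i → a i 1 = 0)
    (hrec : ∀ i j : ℕ, 1 < i → 1 < j →
      a i j = (∑ l ∈ Finset.Icc 1 (i - 1), a l (j - 1))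
            - (∑ l ∈ Finset.Icc 1 (i - 1), a l j) + a (i - 1) (j - 1)) :
    ∀ n : ℕ, 0 < n → ∀ g h : G,
      (xPerm G ^ n * sigma' g * (xPerm G ^ n)⁻¹)⁻¹ * (sigma' h)⁻¹ *
          (xPerm G ^ n * sigma' g * (xPerm G ^ n)⁻¹) * sigma' h
        = ((List.range n).map (fun k =>
            xPerm G ^ (k + 1) *
              sigma' ((g⁻¹)⁻¹ * (h ^ a n (k + 1))⁻¹ * g⁻¹ * h ^ a n (k + 1)) *
              (xPerm G ^ (k + 1))⁻¹)).prod := by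
  intro n hn g h
  have hc := hG g h
  have hfactor (k : ℕ) : xPerm G ^ (k + 1) *
      sigma' ((g⁻¹)⁻¹ * (h ^ a n (k + 1))⁻¹ * g⁻¹ * h ^ a n (k + 1)) * (xPerm G ^ (k + 1))⁻¹ =
      shiftBy (g⁻¹ * h⁻¹ * g * h)
        (-((a n (k + 1) : PowerSeries ℤ) * (1 - PowerSeries.X) ^ (k + 1))) := by
    have h1 := zpow_mul_zpow_of_center hc (show g * h = h * g * _ by group) (-1) (a n (k + 1))
    have h2 : (g⁻¹)⁻¹ * (h ^ a n (k + 1))⁻¹ * g⁻¹ * h ^ a n (k + 1) =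
        (g⁻¹ * h⁻¹ * g * h) ^ (-a n (k + 1)) := by
      rw [zpow_neg_one, neg_one_mul] at h1
      rw [mul_assoc, h1]
      group
    rw [h2, sigma'_zpow_eq_shiftBy hc, xPerm_pow_mul_shiftBy hc, mul_inv_cancel_right]
    congr 1
    push_cast
    ring
  obtain ⟨n, rfl⟩ : ∃ m, n = m + 1 := ⟨n - 1, by omega⟩
  simp only [hfactor]
  rw [prod_shiftBy, Finset.sum_neg_distrib, sum_relation_coeff a h11 h21 h1j hi1 hrec, neg_neg,
    mul_assoc, conj_sigma'_mul_sigma' hG, ← mul_assoc (shiftBy _ _), ← sigma'_mul_shiftBy,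
    mul_assoc (sigma' h), ← conj_sigma'_mul_shiftBy hc]
  group
end
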